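/- For all permutations σ, π of [n], the average of (T2(σ,π) − T2'(σ,π,i1,i2,i3,b))² — taken over all ordered triples (i1,i2,i3) ∈ [n]³ of pairwise distinct elements (each with weight 1/(n(n−1)(n−2))) and over b ∈ {1,2} (each with weight 1/2) — is at most (9/n)·T2(σ,π) + 9n·μ2/((n−1)(n−2)). -/

import Mathlib

/-- The 3-cycle sending `i1 ↦ i2, i2 ↦ i3, i3 ↦ i1` (for pairwise distinct
`i1, i2, i3`), fixing all other elements. -/
def tau1 {n : ℕ} (i1 i2 i3 : Fin n) : Equiv.Perm (Fin n) :=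
  Equiv.swap i1 i3 * Equiv.swap i1 i2

/-- The inverse 3-cycle, sending `i1 ↦ i3, i3 ↦ i2, i2 ↦ i1`. -/
def tau2 {n : ℕ} (i1 i2 i3 : Fin n) : Equiv.Perm (Fin n) :=
  (tau1 i1 i2 i3)⁻¹

section ThreeCycle

variable {n : ℕ} {i j k : Fin n}

theorem tau1_apply_first (hij : i ≠ j) (hjk : j ≠ k) : tau1 i j k i = j := by
  simp [tau1, Equiv.swap_apply_of_ne_of_ne hij.symm hjk]

theorem tau1_apply_second (i j k : Fin n) : tau1 i j k j = k := by
  simp [tau1]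

theorem tau1_apply_third (hik : i ≠ k) (hjk : j ≠ k) : tau1 i j k k = i := by
  simp [tau1, Equiv.swap_apply_of_ne_of_ne hik.symm hjk.symm]

theorem tau1_apply_of_ne {x : Fin n} (hi : x ≠ i) (hj : x ≠ j) (hk : x ≠ k) :
    tau1 i j k x = x := by
  simp [tau1, Equiv.swap_apply_of_ne_of_ne, hi, hj, hk]

theorem tau2_apply_first (hik : i ≠ k) (hjk : j ≠ k) : tau2 i j k i = k := by
  rw [tau2, Equiv.Perm.inv_eq_iff_eq, tau1_apply_third hik hjk]

theorem tau2_apply_second (hij : i ≠ j) (hjk : j ≠ k) : tau2 i j k j = i := by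
  rw [tau2, Equiv.Perm.inv_eq_iff_eq, tau1_apply_first hij hjk]

theorem tau2_apply_third (i j k : Fin n) : tau2 i j k k = j := by
  rw [tau2, Equiv.Perm.inv_eq_iff_eq, tau1_apply_second]

theorem tau2_apply_of_ne {x : Fin n} (hi : x ≠ i) (hj : x ≠ j) (hk : x ≠ k) :
    tau2 i j k x = x := by
  rw [tau2, Equiv.Perm.inv_eq_iff_eq, tau1_apply_of_ne hi hj hk]

end ThreeCycle

/-- Two sums whose terms agree off three distinct points differ only in those points. -/
theorem sum_sub_sum_eq_of_eq_off_triple {ι : Type*} [Fintype ι] [DecidableEq ι] (f g : ι → ℝ)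
    {i j k : ι} (hij : i ≠ j) (hik : i ≠ k) (hjk : j ≠ k)
    (h : ∀ x, x ≠ i → x ≠ j → x ≠ k → f x = g x) :
    ∑ x, f x - ∑ x, g x = (f i + f j + f k) - (g i + g j + g k) := by
  rw [← Finset.sum_sub_distrib, ← Finset.sum_subset (Finset.subset_univ {i, j, k})]
  · rw [Finset.sum_insert (by simp [hij, hik]), Finset.sum_pair hjk]
    ring
  · intro x _ hx
    simp only [Finset.mem_insert, Finset.mem_singleton, not_or] at hx
    rw [h x hx.1 hx.2.1 hx.2.2, sub_self]

theorem sub_sq_le_mul_add {x y c : ℝ} (hx : 0 ≤ x) (hy : 0 ≤ y) (hxc : x ≤ c) (hyc : y ≤ c) :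
    (x - y) ^ 2 ≤ c * (x + y) := by
  nlinarith [mul_nonneg hx hy, mul_nonneg hx (sub_nonneg.2 hxc), mul_nonneg hy (sub_nonneg.2 hyc)]

/-- The ordered triples of pairwise distinct elements of `Fin n`. -/
def distinctTriples (n : ℕ) : Finset (Fin n × Fin n × Fin n) :=
  Finset.univ.filter (fun p => p.1 ≠ p.2.1 ∧ p.1 ≠ p.2.2 ∧ p.2.1 ≠ p.2.2)

theorem sum_distinctTriples_rotate {n : ℕ} (f : Fin n × Fin n × Fin n → ℝ) :
    ∑ p ∈ distinctTriples n, f (p.2.1, p.2.2, p.1) = ∑ p ∈ distinctTriples n, f p := by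
  refine Finset.sum_bij' (fun p _ => (p.2.1, p.2.2, p.1)) (fun p _ => (p.2.2, p.1, p.2.1))
    ?_ ?_ ?_ ?_ ?_ <;> simp +contextual [distinctTriples, eq_comm]

theorem sum_distinctTriples_fst {n : ℕ} (hn : 2 ≤ n) (f : Fin n → ℝ) :
    ∑ p ∈ distinctTriples n, f p.1 = ((n : ℝ) - 1) * (n - 2) * ∑ i, f i := by
  have inner (i j : Fin n) : (∑ k, if i ≠ j ∧ i ≠ k ∧ j ≠ k then f i else 0) =
      if j ∈ Finset.univ.erase i then ((n : ℝ) - 2) * f i else 0 := by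
    by_cases hij : i = j
    · simp [hij]
    · have hfilter : Finset.univ.filter (fun k => i ≠ j ∧ i ≠ k ∧ j ≠ k) =
          (Finset.univ : Finset (Fin n)) \ {i, j} := by
        ext k
        simp [hij, eq_comm]
      rw [← Finset.sum_filter, hfilter, Finset.sum_const,
        Finset.card_sdiff_of_subset (Finset.subset_univ _), Finset.card_pair hij]
      simp [Ne.symm hij, Nat.cast_sub hn]
  rw [distinctTriples, Finset.sum_filter, Fintype.sum_prod_type, Finset.mul_sum]
  refine Finset.sum_congr rfl fun i _ => ?_
  rw [Fintype.sum_prod_type]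
  simp only [inner]
  rw [← Finset.sum_filter, Finset.filter_mem_eq_inter, Finset.univ_inter, Finset.sum_const,
    Finset.card_erase_of_mem (Finset.mem_univ i), Finset.card_univ, Fintype.card_fin,
    nsmul_eq_mul, Nat.cast_sub (by omega)]
  push_cast
  ring

theorem sum_distinctTriples_le {n : ℕ} {f : Fin n × Fin n × Fin n → ℝ} (hf : ∀ p, 0 ≤ f p) :
    ∑ p ∈ distinctTriples n, f p ≤ ∑ p, f p :=
  Finset.sum_le_sum_of_subset_of_nonneg (Finset.subset_univ _) fun p _ _ => hf p

theorem sum_comp_perm_perm {n : ℕ} (a : Fin n → Fin n → Fin n → ℝ)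
    (σ π : Equiv.Perm (Fin n)) :
    ∑ p : Fin n × Fin n × Fin n, a p.1 (σ p.2.1) (π p.2.2) = ∑ i, ∑ j, ∑ k, a i j k := by
  simp only [Fintype.sum_prod_type]
  refine Finset.sum_congr rfl fun i _ => ?_
  rw [← Equiv.sum_comp σ fun j => ∑ k, a i j k]
  exact Finset.sum_congr rfl fun j _ => Equiv.sum_comp π (a i (σ j))

theorem sum_comp_perm_perm_swap {n : ℕ} (a : Fin n → Fin n → Fin n → ℝ)
    (σ π : Equiv.Perm (Fin n)) :
    ∑ p : Fin n × Fin n × Fin n, a p.1 (σ p.2.2) (π p.2.1) = ∑ i, ∑ j, ∑ k, a i j k := by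
  rw [← sum_comp_perm_perm a σ π]
  simp only [Fintype.sum_prod_type]
  exact Finset.sum_congr rfl fun i _ => Finset.sum_comm

/-- The average of `(T₂ - T₂')²` over the uniformly chosen pairwise distinct triple
`(i₁,i₂,i₃)` and the fair coin `b ∈ {1,2}` is at most `(9/n)·T₂ + 9n·μ₂/((n-1)(n-2))`,
where `T₂ = ∑ i, a i (σ i) (π i)`, `μ₂ = (∑ i, ∑ j, ∑ k, a i j k)/n²`, and for `b = 1`
(resp. `b = 2`) `T₂' = ∑ i, a i (σ (τ₁ i)) (π (τ₂ i))` (resp. with `τ₁, τ₂` swapped). -/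
theorem T2_second_moment_bound
    (n : ℕ) (hn : 3 ≤ n) (a : Fin n → Fin n → Fin n → ℝ)
    (ha : ∀ i j k, a i j k ∈ Set.Icc (0 : ℝ) 1) (σ π : Equiv.Perm (Fin n)) :
    (∑ p ∈ Finset.univ.filter
        (fun p : Fin n × Fin n × Fin n =>
          p.1 ≠ p.2.1 ∧ p.1 ≠ p.2.2 ∧ p.2.1 ≠ p.2.2),
      (((∑ i, a i (σ i) (π i)) -
          ∑ i, a i (σ (tau1 p.1 p.2.1 p.2.2 i)) (π (tau2 p.1 p.2.1 p.2.2 i))) ^ 2 +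
        ((∑ i, a i (σ i) (π i)) -
          ∑ i, a i (σ (tau2 p.1 p.2.1 p.2.2 i)) (π (tau1 p.1 p.2.1 p.2.2 i))) ^ 2) / 2) /
      ((n : ℝ) * (n - 1) * (n - 2)) ≤
    (9 / (n : ℝ)) * (∑ i, a i (σ i) (π i)) +
      9 * (n : ℝ) * ((∑ i, ∑ j, ∑ k, a i j k) / (n ^ 2 : ℝ)) /
        (((n : ℝ) - 1) * ((n : ℝ) - 2)) := by
  change (∑ p ∈ distinctTriples n, _) / _ ≤ _
  have h0 i j k := (ha i j k).1
  set T := ∑ i, a i (σ i) (π i) with hT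
  set M := ∑ i, ∑ j, ∑ k, a i j k
  have hn' : (3 : ℝ) ≤ n := by exact_mod_cast hn
  let g : Fin n × Fin n × Fin n → ℝ := fun p =>
    3 * a p.1 (σ p.1) (π p.1) +
      3 / 2 * (a p.1 (σ p.2.1) (π p.2.2) + a p.1 (σ p.2.2) (π p.2.1))
  have hg : ∑ p ∈ distinctTriples n, g p ≤ 3 * (((n : ℝ) - 1) * (n - 2) * T) + 3 * M := by
    simp only [g, Finset.sum_add_distrib, ← Finset.mul_sum]
    have hdiag := sum_distinctTriples_fst (by omega : 2 ≤ n) fun i => a i (σ i) (π i)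
    have hle := sum_distinctTriples_le (n := n)
      (f := fun p => a p.1 (σ p.2.1) (π p.2.2)) fun _ => h0 _ _ _
    have hle_swap := sum_distinctTriples_le (n := n)
      (f := fun p => a p.1 (σ p.2.2) (π p.2.1)) fun _ => h0 _ _ _
    rw [sum_comp_perm_perm a σ π] at hle
    rw [sum_comp_perm_perm_swap a σ π] at hle_swap
    linarith
  have hsum : ∑ p ∈ distinctTriples n,
      ((T - ∑ i, a i (σ (tau1 p.1 p.2.1 p.2.2 i)) (π (tau2 p.1 p.2.1 p.2.2 i))) ^ 2 +
        (T - ∑ i, a i (σ (tau2 p.1 p.2.1 p.2.2 i)) (π (tau1 p.1 p.2.1 p.2.2 i))) ^ 2) / 2 ≤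
      3 * ∑ p ∈ distinctTriples n, g p := by
    have hrot := sum_distinctTriples_rotate g
    have hrot_rot := sum_distinctTriples_rotate fun p => g (p.2.1, p.2.2, p.1)
    calc _ ≤ ∑ p ∈ distinctTriples n,
          (g p + g (p.2.1, p.2.2, p.1) + g (p.2.2, p.1, p.2.1)) := by
          refine Finset.sum_le_sum ?_
          rintro ⟨i, j, k⟩ hp
          simp only [distinctTriples, Finset.mem_filter, Finset.mem_univ, true_and] at hp
          obtain ⟨hij, hik, hjk⟩ := hp
          dsimp only
          rw [hT, sum_sub_sum_eq_of_eq_off_triple _ _ hij hik hjk fun x hi hj hk => by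
              rw [tau1_apply_of_ne hi hj hk, tau2_apply_of_ne hi hj hk],
            sum_sub_sum_eq_of_eq_off_triple _ _ hij hik hjk fun x hi hj hk => by
              rw [tau1_apply_of_ne hi hj hk, tau2_apply_of_ne hi hj hk],
            tau1_apply_first hij hjk, tau1_apply_second, tau1_apply_third hik hjk,
            tau2_apply_first hik hjk, tau2_apply_second hij hjk, tau2_apply_third]
          have bound {x y z u v w : ℝ} (hx : x ∈ Set.Icc 0 1) (hy : y ∈ Set.Icc 0 1)
              (hz : z ∈ Set.Icc 0 1) (hu : u ∈ Set.Icc 0 1) (hv : v ∈ Set.Icc 0 1)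
              (hw : w ∈ Set.Icc 0 1) :
              ((x + y + z) - (u + v + w)) ^ 2 ≤ 3 * ((x + y + z) + (u + v + w)) := by
            obtain ⟨⟨_, _⟩, ⟨_, _⟩, ⟨_, _⟩, ⟨_, _⟩, ⟨_, _⟩, ⟨_, _⟩⟩ :=
              And.intro hx (And.intro hy (And.intro hz (And.intro hu (And.intro hv hw))))
            apply sub_sq_le_mul_add <;> linarith
          have hb1 := bound (ha i (σ i) (π i)) (ha j (σ j) (π j)) (ha k (σ k) (π k))
            (ha i (σ j) (π k)) (ha j (σ k) (π i)) (ha k (σ i) (π j))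
          have hb2 := bound (ha i (σ i) (π i)) (ha j (σ j) (π j)) (ha k (σ k) (π k))
            (ha i (σ k) (π j)) (ha j (σ i) (π k)) (ha k (σ j) (π i))
          simp only [g]
          linarith
      _ = 3 * ∑ p ∈ distinctTriples n, g p := by
          simp only [Finset.sum_add_distrib]
          linarith
  have hn1 : (0 : ℝ) < n - 1 := by linarith
  have hn2 : (0 : ℝ) < n - 2 := by linarith
  have hn0 : (0 : ℝ) < n := by linarith
  rw [div_le_iff₀ (by positivity)]
  have hrhs : (9 / (n : ℝ) * T + 9 * n * (M / (n ^ 2 : ℝ)) / (((n : ℝ) - 1) * (n - 2))) *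
      (n * (n - 1) * (n - 2)) = 3 * (3 * (((n : ℝ) - 1) * (n - 2) * T) + 3 * M) := by
    field_simp
    ring
  rw [hrhs]
  linarith
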